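/- Let A, B₁,…,B_m ∈ 𝓛(ℋ) be selfadjoint with m ≥ 2 and assume {B₁,…,B_m} is strongly indefinite. Then ⟨Ax, x⟩ ≥ 0 for every x ∈ ⋂_{i=1}^m Qᵢ if and only if there exist λ₁,…,λ_m ∈ ℝ such that A + ∑_{i=1}^m λᵢBᵢ ≥ 0. -/

import Mathlib

open scoped InnerProductSpace

variable {H : Type*} [NormedAddCommGroup H] [InnerProductSpace ℂ H] [CompleteSpace H]

/-- The real quadratic form `x ↦ Re⟨B x, x⟩` associated to a bounded operator `B`. -/
noncomputable def qf (B : H →L[ℂ] H) (x : H) : ℝ := (⟪B x, x⟫_ℂ).re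

/-- An operator `A` is positive semidefinite if `⟨A x, x⟩ ≥ 0` for all `x`. -/
def PosSemidef (A : H →L[ℂ] H) : Prop := ∀ x : H, 0 ≤ qf A x

/-- A selfadjoint operator is indefinite if its quadratic form takes both strictly
positive and strictly negative values. -/
def Indefinite (B : H →L[ℂ] H) : Prop := (∃ x : H, 0 < qf B x) ∧ (∃ x : H, qf B x < 0)

/-- `Q(B)` : the set of neutral vectors of the quadratic form of `B`. -/
def Qset (B : H →L[ℂ] H) : Set H := {x : H | qf B x = 0}

/-- `B` is indefinite on a set `S` if its quadratic form takes both strictly positive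
and strictly negative values on `S`. -/
def IndefiniteOn (B : H →L[ℂ] H) (S : Set H) : Prop :=
  (∃ x ∈ S, 0 < qf B x) ∧ (∃ x ∈ S, qf B x < 0)

/-- A family `{B₁,…,B_m}` is weakly indefinite if every nontrivial real linear
combination `∑ μᵢ Bᵢ` is indefinite. -/
def WeaklyIndefinite {m : ℕ} (B : Fin m → (H →L[ℂ] H)) : Prop :=
  ∀ μ : Fin m → ℝ, μ ≠ 0 → Indefinite (∑ i, μ i • B i)

/-- A family `{B₁,…,B_m}` is indefinite if each `B_j` is indefinite on `⋂_{i≠j} Qᵢ`. -/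
def IndefiniteFamily {m : ℕ} (B : Fin m → (H →L[ℂ] H)) : Prop :=
  ∀ j : Fin m, IndefiniteOn (B j) {x : H | ∀ i, i ≠ j → qf (B i) x = 0}

/-- A family `{B₁,…,B_m}` is strongly indefinite if it is weakly indefinite and for all
indices `i, j, k`, whenever `x₋ ∈ 𝒫ᵢ⁻ ∩ Q_j ∩ Q_k` and `x₊ ∈ 𝒫ᵢ⁺ ∩ Q_j ∩ Q_k` there is
`θ ∈ [0, π)` with `Re⟨B_j x₊, e^{iθ} x₋⟩ = Re⟨B_k x₊, e^{iθ} x₋⟩ = 0`. -/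
def StronglyIndefinite {m : ℕ} (B : Fin m → (H →L[ℂ] H)) : Prop :=
  WeaklyIndefinite B ∧
  ∀ i j k : Fin m, ∀ xm xp : H,
    qf (B i) xm < 0 → qf (B j) xm = 0 → qf (B k) xm = 0 →
    0 < qf (B i) xp → qf (B j) xp = 0 → qf (B k) xp = 0 →
    ∃ θ : ℝ, θ ∈ Set.Ico 0 Real.pi ∧
      (⟪(B j) xp, Complex.exp (θ * Complex.I) • xm⟫_ℂ).re = 0 ∧
      (⟪(B k) xp, Complex.exp (θ * Complex.I) • xm⟫_ℂ).re = 0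

section InnerProductSpace

variable {E : Type*} [NormedAddCommGroup E] [InnerProductSpace ℂ E]

lemma qf_smul (B : E →L[ℂ] E) (c : ℂ) (x : E) : qf B (c • x) = ‖c‖ ^ 2 * qf B x := by
  unfold qf
  rw [map_smul, inner_smul_left, inner_smul_right, ← mul_assoc, Complex.conj_mul',
    ← Complex.ofReal_pow, Complex.re_ofReal_mul]

lemma qf_add_operator (A B : E →L[ℂ] E) (x : E) : qf (A + B) x = qf A x + qf B x := by
  simp [qf]

lemma qf_smul_operator (r : ℝ) (B : E →L[ℂ] E) (x : E) : qf (r • B) x = r * qf B x := by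
  simp [qf, inner_smul_left_eq_smul]

lemma qf_sum_operator {ι : Type*} (s : Finset ι) (B : ι → E →L[ℂ] E) (x : E) :
    qf (∑ i ∈ s, B i) x = ∑ i ∈ s, qf (B i) x := by
  simp [qf]

lemma qf_smul_add (B : E →L[ℂ] E) (t : ℝ) (x y : E) :
    qf B ((t : ℂ) • x + y) =
      t ^ 2 * qf B x + t * ((⟪B x, y⟫_ℂ).re + (⟪B y, x⟫_ℂ).re) + qf B y := by
  simp only [qf, map_add, map_smul, inner_add_left, inner_add_right, inner_smul_left,
    inner_smul_right, Complex.conj_ofReal, Complex.add_re, Complex.re_ofReal_mul]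
  ring

/-- Complex numbers that can pairwise be rotated onto the imaginary axis by a common rotation
can all be rotated there simultaneously. -/
lemma exists_common_rotation {ι : Type*} (s : Set ι) (z : ι → ℂ)
    (h : ∀ j ∈ s, ∀ k ∈ s, ∃ θ : ℝ, (Complex.exp (θ * Complex.I) * z j).re = 0 ∧
      (Complex.exp (θ * Complex.I) * z k).re = 0) :
    ∃ θ : ℝ, ∀ j ∈ s, (Complex.exp (θ * Complex.I) * z j).re = 0 := by
  by_cases hz : ∀ j ∈ s, z j = 0
  · exact ⟨0, fun j hj => by simp [hz j hj]⟩
  push Not at hz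
  obtain ⟨j, hj, hzj⟩ := hz
  obtain ⟨θ, hθ, -⟩ := h j hj j hj
  refine ⟨θ, fun k hk => ?_⟩
  obtain ⟨φ, hφj, hφk⟩ := h j hj k hk
  set u := Complex.exp (θ * Complex.I)
  set w := Complex.exp (φ * Complex.I)
  have hw : w * z j ≠ 0 := mul_ne_zero (Complex.exp_ne_zero _) hzj
  have him : (w * z j).im ≠ 0 := fun h0 => hw (Complex.ext hφj h0)
  have hcross : (w * z j) * (u * z k) = (u * z j) * (w * z k) := by ring
  have him_eq := congrArg Complex.im hcross
  rw [Complex.mul_im, Complex.mul_im (u * z j), hφj, hθ, hφk, zero_mul, zero_mul, mul_zero,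
    zero_add, add_zero] at him_eq
  exact (mul_eq_zero.mp him_eq).resolve_left him

/-- A real quadratic polynomial with coefficients `a > 0`, `b`, `c < 0` has roots of both signs. -/
lemma exists_pos_neg_roots {a b c : ℝ} (ha : 0 < a) (hc : c < 0) :
    ∃ t₁ t₂ : ℝ, 0 < t₁ ∧ 0 < t₂ ∧ a * (t₁ * t₂) = -c ∧
      t₁ ^ 2 * a + t₁ * b + c = 0 ∧ (-t₂) ^ 2 * a + (-t₂) * b + c = 0 := by
  have hac : a * c < 0 := mul_neg_of_pos_of_neg ha hc
  set d := √(b ^ 2 - 4 * a * c)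
  have hd : d ^ 2 = b ^ 2 - 4 * a * c := Real.sq_sqrt (by nlinarith [sq_nonneg b])
  have hbd : |b| < d := Real.lt_sqrt_of_sq_lt (by rw [sq_abs]; linarith)
  obtain ⟨h₁, h₂⟩ := abs_lt.mp hbd
  refine ⟨(d - b) / (2 * a), (d + b) / (2 * a), by apply div_pos <;> linarith,
    by apply div_pos <;> linarith, ?_, ?_, ?_⟩ <;> field_simp <;> linarith

/-- If `A` is nonnegative on the neutral vectors of `B` in the real span of `x` and `y`, where
`x` is positive and `y` is negative for `B`, then the multipliers required at `x` and at `y` are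
compatible. -/
lemma neg_qf_div_le_of_nonneg_on_neutral (A B : E →L[ℂ] E) {x y : E} (hx : 0 < qf B x)
    (hy : qf B y < 0)
    (h : ∀ t : ℝ, qf B ((t : ℂ) • x + y) = 0 → 0 ≤ qf A ((t : ℂ) • x + y)) :
    -qf A x / qf B x ≤ -qf A y / qf B y := by
  obtain ⟨t₁, t₂, ht₁, ht₂, hprod, hr₁, hr₂⟩ :=
    exists_pos_neg_roots (b := (⟪B x, y⟫_ℂ).re + (⟪B y, x⟫_ℂ).re) hx hy
  have h₁ := h t₁ (by rw [qf_smul_add]; exact hr₁)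
  have h₂ := h (-t₂) (by rw [qf_smul_add]; exact hr₂)
  rw [qf_smul_add] at h₁ h₂
  have hsum : 0 ≤ (t₁ + t₂) * (t₁ * t₂ * qf A x + qf A y) := by
    nlinarith [mul_nonneg ht₂.le h₁, mul_nonneg ht₁.le h₂]
  have hnonneg : 0 ≤ t₁ * t₂ * qf A x + qf A y := nonneg_of_mul_nonneg_right hsum (by positivity)
  have hmul : 0 ≤ qf B x * qf A y - qf B y * qf A x := by
    have := mul_nonneg hx.le hnonneg
    linear_combination this + qf A x * hprod
  rw [← neg_div_neg_eq (-qf A y), neg_neg, div_le_div_iff₀ hx (neg_pos.mpr hy)]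
  linarith

/-- Pairwise compatible multipliers for the vectors of `S` can be replaced by a single one when `B`
is indefinite on `S`. -/
lemma exists_multiplier_of_indefiniteOn (A B : E →L[ℂ] E) {S : Set E} (hB : IndefiniteOn B S)
    (h₀ : ∀ x ∈ S, qf B x = 0 → 0 ≤ qf A x)
    (h : ∀ x ∈ S, ∀ y ∈ S, 0 < qf B x → qf B y < 0 →
      -qf A x / qf B x ≤ -qf A y / qf B y) :
    ∃ r : ℝ, ∀ x ∈ S, 0 ≤ qf (A + r • B) x := by
  obtain ⟨⟨p, hpS, hp⟩, n, hnS, hn⟩ := hB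
  set T : Set ℝ := (fun x => -qf A x / qf B x) '' {x | x ∈ S ∧ 0 < qf B x}
  have hT : T.Nonempty := ⟨_, p, ⟨hpS, hp⟩, rfl⟩
  have hub : ∀ y ∈ S, qf B y < 0 → -qf A y / qf B y ∈ upperBounds T := by
    rintro y hyS hy _ ⟨x, ⟨hxS, hx⟩, rfl⟩
    exact h x hxS y hyS hx hy
  refine ⟨sSup T, fun x hxS => ?_⟩
  rw [qf_add_operator, qf_smul_operator]
  rcases lt_trichotomy (qf B x) 0 with hx | hx | hx
  · have := csSup_le hT (hub x hxS hx)
    rw [le_div_iff_of_neg hx] at this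
    linarith
  · simpa [hx] using h₀ x hxS hx
  · have := le_csSup ⟨_, hub n hnS hn⟩ (Set.mem_image_of_mem _ ⟨hxS, hx⟩)
    rw [div_le_iff₀ hx] at this
    linarith

lemma StronglyIndefinite.exists_common_phase {m : ℕ} {B : Fin m → (E →L[ℂ] E)}
    (hstr : StronglyIndefinite B) (s : Finset (Fin m)) {i : Fin m} {x y : E}
    (hx : ∀ j ∈ s, qf (B j) x = 0) (hy : ∀ j ∈ s, qf (B j) y = 0)
    (hix : 0 < qf (B i) x) (hiy : qf (B i) y < 0) :
    ∃ θ : ℝ, ∀ j ∈ s, (⟪B j x, Complex.exp (θ * Complex.I) • y⟫_ℂ).re = 0 := by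
  simp only [inner_smul_right]
  refine exists_common_rotation (s : Set (Fin m)) (fun j => ⟪B j x, y⟫_ℂ) fun j hj k hk => ?_
  obtain ⟨θ, -, hθ⟩ := hstr.2 i j k y x hiy (hy j hj) (hy k hk) hix (hx j hj) (hx k hk)
  exact ⟨θ, by simpa only [inner_smul_right] using hθ⟩

lemma WeaklyIndefinite.not_posSemidef_smul_add {m : ℕ} {B : Fin m → (E →L[ℂ] E)}
    (hB : WeaklyIndefinite B) {s : Finset (Fin m)} {i : Fin m} (hi : i ∉ s) {r : ℝ} (hr : r ≠ 0)
    (l : Fin m → ℝ) : ¬ PosSemidef (r • B i + ∑ j ∈ s, l j • B j) := by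
  intro hpos
  let μ : Fin m → ℝ := fun j => if j ∈ insert i s then (if j = i then r else l j) else 0
  have hμ : μ ≠ 0 := fun h => hr (by simpa [μ] using congrFun h i)
  have hsum : ∑ j, μ j • B j = r • B i + ∑ j ∈ s, l j • B j := by
    simp only [μ, ite_smul, zero_smul]
    rw [Finset.sum_ite_mem, Finset.univ_inter, Finset.sum_insert hi, if_pos rfl]
    congr 1
    exact Finset.sum_congr rfl fun j hj => if_neg (ne_of_mem_of_not_mem hj hi)
  obtain ⟨x, hx⟩ := (hB μ hμ).2
  rw [hsum] at hx
  exact (hpos x).not_gt hx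

end InnerProductSpace

lemma re_inner_apply_comm {B : H →L[ℂ] H} (hB : IsSelfAdjoint B) (x y : H) :
    (⟪B y, x⟫_ℂ).re = (⟪B x, y⟫_ℂ).re := by
  have h : ⟪B y, x⟫_ℂ = ⟪y, B x⟫_ℂ := hB.isSymmetric y x
  rw [h]
  exact inner_re_symm (𝕜 := ℂ) y (B x)

lemma StronglyIndefinite.div_le_div_of_nonneg {m : ℕ} {B : Fin m → (H →L[ℂ] H)}
    (hstr : StronglyIndefinite B) (hB : ∀ i, IsSelfAdjoint (B i)) (A : H →L[ℂ] H)
    {s : Finset (Fin m)} {i : Fin m}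
    (hA : ∀ x : H, (∀ j ∈ insert i s, qf (B j) x = 0) → 0 ≤ qf A x) {x y : H}
    (hx : ∀ j ∈ s, qf (B j) x = 0) (hy : ∀ j ∈ s, qf (B j) y = 0)
    (hix : 0 < qf (B i) x) (hiy : qf (B i) y < 0) :
    -qf A x / qf (B i) x ≤ -qf A y / qf (B i) y := by
  obtain ⟨θ, hθ⟩ := hstr.exists_common_phase s hx hy hix hiy
  set y' := Complex.exp (θ * Complex.I) • y
  have hqf : ∀ C : H →L[ℂ] H, qf C y' = qf C y := fun C => by
    rw [qf_smul, Complex.norm_exp_ofReal_mul_I, one_pow, one_mul]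
  rw [← hqf A, ← hqf (B i)]
  refine neg_qf_div_le_of_nonneg_on_neutral A (B i) hix (by rwa [hqf]) fun t ht => hA _ ?_
  intro j hj
  rcases Finset.mem_insert.mp hj with rfl | hjs
  · exact ht
  · rw [qf_smul_add, re_inner_apply_comm (hB j) x, hθ j hjs, hqf, hx j hjs, hy j hjs]
    ring

/-- The multiplier rule for a subfamily of a strongly indefinite family. -/
lemma StronglyIndefinite.exists_multipliers {m : ℕ} {B : Fin m → (H →L[ℂ] H)}
    (hstr : StronglyIndefinite B) (hB : ∀ i, IsSelfAdjoint (B i)) (s : Finset (Fin m)) :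
    ∀ A : H →L[ℂ] H, (∀ x : H, (∀ i ∈ s, qf (B i) x = 0) → 0 ≤ qf A x) →
      ∃ l : Fin m → ℝ, PosSemidef (A + ∑ i ∈ s, l i • B i) := by
  induction s using Finset.induction_on with
  | empty => exact fun A hA => ⟨0, fun x => by simpa using hA x (by simp)⟩
  | insert i s hi ih =>
    intro A hA
    have hneg : ∀ r : ℝ, r ≠ 0 → ∃ x, (∀ j ∈ s, qf (B j) x = 0) ∧ r * qf (B i) x < 0 := by
      intro r hr
      by_contra! hcon
      obtain ⟨l, hl⟩ := ih (r • B i) fun x hx => by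
        rw [qf_smul_operator]
        exact hcon x hx
      exact hstr.1.not_posSemidef_smul_add hi hr l hl
    have hindef : IndefiniteOn (B i) {x | ∀ j ∈ s, qf (B j) x = 0} := by
      obtain ⟨p, hp, hp'⟩ := hneg (-1) (by norm_num)
      obtain ⟨n, hn, hn'⟩ := hneg 1 one_ne_zero
      exact ⟨⟨p, hp, by linarith⟩, n, hn, by linarith⟩
    obtain ⟨r, hr⟩ := exists_multiplier_of_indefiniteOn A (B i) hindef
      (fun x hx hix => hA x (by
        simp only [Finset.forall_mem_insert]
        exact ⟨hix, hx⟩))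
      fun x hx y hy => hstr.div_le_div_of_nonneg hB A hA hx hy
    obtain ⟨l, hl⟩ := ih (A + r • B i) hr
    refine ⟨Function.update l i r, ?_⟩
    rw [Finset.sum_insert hi, Function.update_self, ← add_assoc]
    convert hl using 2
    exact Finset.sum_congr rfl fun j hj => by
      rw [Function.update_of_ne (ne_of_mem_of_not_mem hj hi)]

/-- Generalized Krein–Šmul'jan theorem: if `{B₁,…,B_m}` is strongly indefinite, then
`A ≥ 0` on `⋂ᵢ Qᵢ` iff `A + ∑ᵢ λᵢBᵢ ≥ 0` for some `λ₁,…,λ_m ∈ ℝ`. -/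
theorem krein_smuljan_generalized {m : ℕ} (hm : 2 ≤ m) (A : H →L[ℂ] H)
    (B : Fin m → (H →L[ℂ] H)) (hA : IsSelfAdjoint A) (hB : ∀ i, IsSelfAdjoint (B i))
    (hstr : StronglyIndefinite B) :
    (∀ x : H, (∀ i, qf (B i) x = 0) → 0 ≤ qf A x) ↔
      ∃ l : Fin m → ℝ, PosSemidef (A + ∑ i, l i • B i) := by
  constructor
  · intro h
    exact hstr.exists_multipliers hB Finset.univ A fun x hx => h x fun i => hx i (Finset.mem_univ i)
  · rintro ⟨l, hl⟩ x hx
    simpa [qf_add_operator, qf_sum_operator, qf_smul_operator, hx] using hl x
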